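/- Let H₁, H₂ be real Hilbert spaces, A : H₁ → H₂ bounded linear with adjoint A*, S : H₂ → H₂ firmly nonexpansive, and 0 < γ < 2/‖A‖². For w ∈ H₁ and x* with Ax* ∈ F(S), set z = w − γ A*(I − S)Aw. Then ½‖z − x*‖² ≤ ½‖w − x*‖² + (γ²‖A‖²/2 − γ)‖(I − S)Aw‖² ≤ ½‖w − x*‖². -/

import Mathlib

open RealInnerProductSpace

/-- If `S` is firmly nonexpansive, the residual `x - S x` makes an inner product of at least
`‖x - S x‖ ^ 2` with the displacement of `x` from any fixed point of `S`. -/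
theorem sq_norm_residual_le_inner_sub_fixedPoint
    {H : Type*} [NormedAddCommGroup H] [InnerProductSpace ℝ H] {S : H → H}
    (hS : ∀ x y : H, ⟪S x - S y, x - y⟫ ≥ ‖S x - S y‖ ^ 2)
    {p : H} (hp : S p = p) (x : H) :
    ‖x - S x‖ ^ 2 ≤ ⟪x - p, x - S x⟫ := by
  have h := hS x p
  have hsub : S x - S p = (x - p) - (x - S x) := by rw [hp]; abel
  rw [hsub, norm_sub_sq_real, inner_sub_left, real_inner_self_eq_norm_sq,
    real_inner_comm (x - p) (x - S x)] at h
  linarith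

/-- Key inequality for the gradient-type step z = w − γ A*(I − S)Aw. -/
theorem gradient_step_key_inequality
    {H₁ H₂ : Type*} [NormedAddCommGroup H₁] [InnerProductSpace ℝ H₁] [CompleteSpace H₁]
    [NormedAddCommGroup H₂] [InnerProductSpace ℝ H₂] [CompleteSpace H₂]
    (A : H₁ →L[ℝ] H₂) (S : H₂ → H₂)
    (hS : ∀ x y : H₂, ⟪S x - S y, x - y⟫ ≥ ‖S x - S y‖ ^ 2)
    (γ : ℝ) (hγ0 : 0 < γ) (hγ2 : γ < 2 / ‖A‖ ^ 2)
    (w xstar : H₁) (hfix : S (A xstar) = A xstar)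
    (z : H₁)
    (hz : z = w - γ • (ContinuousLinearMap.adjoint A) (A w - S (A w))) :
    (1 / 2) * ‖z - xstar‖ ^ 2 ≤
        (1 / 2) * ‖w - xstar‖ ^ 2 +
          (γ ^ 2 * ‖A‖ ^ 2 / 2 - γ) * ‖A w - S (A w)‖ ^ 2 ∧
      (1 / 2) * ‖w - xstar‖ ^ 2 +
          (γ ^ 2 * ‖A‖ ^ 2 / 2 - γ) * ‖A w - S (A w)‖ ^ 2 ≤
        (1 / 2) * ‖w - xstar‖ ^ 2 := by
  have hinner := sq_norm_residual_le_inner_sub_fixedPoint hS hfix (A w)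
  set u := A w - S (A w)
  have hnorm : ‖(ContinuousLinearMap.adjoint A) u‖ ^ 2 ≤ ‖A‖ ^ 2 * ‖u‖ ^ 2 := by
    rw [← mul_pow]
    gcongr
    simpa using (ContinuousLinearMap.adjoint A).le_opNorm u
  have hexp : ‖z - xstar‖ ^ 2 = ‖w - xstar‖ ^ 2 - 2 * (γ * ⟪A w - A xstar, u⟫)
      + γ ^ 2 * ‖(ContinuousLinearMap.adjoint A) u‖ ^ 2 := by
    rw [hz, sub_right_comm, norm_sub_sq_real, inner_smul_right,
      ContinuousLinearMap.adjoint_inner_right, map_sub, norm_smul, mul_pow,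
      Real.norm_eq_abs, sq_abs]
  have hcoef : γ ^ 2 * ‖A‖ ^ 2 / 2 - γ ≤ 0 := by
    have hA : 0 < ‖A‖ ^ 2 :=
      (div_pos_iff_of_pos_left two_pos).1 (hγ0.trans hγ2)
    have := (lt_div_iff₀ hA).1 hγ2
    nlinarith
  constructor
  · have h₁ := mul_le_mul_of_nonneg_left hinner hγ0.le
    have h₂ := mul_le_mul_of_nonneg_left hnorm (sq_nonneg γ)
    rw [hexp]
    linarith
  · have := mul_nonpos_of_nonpos_of_nonneg hcoef (sq_nonneg ‖u‖)
    linarith
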